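/- arXiv:1406.6445 — 3 statements merged into one kernel-verified Lean document; each statement's English description precedes it below -/
import Mathlib

section
/- Let F be a finite field with |F| = 2^f (f ≥ 1), let V be an F-vector space with dim_F V = 3n (n ≥ 1), and let O be a pseudo-hyperoval of V. Suppose there exists an irreducible subgroup G of GL(V) that stabilises O and is transitive on O. Then n·f ≤ 4. -/
/-- Bang's theorem for base two: primitive prime divisors of `2 ^ n - 1` exist for `n ≥ 7`. -/
theorem exists_prime_isPrimitiveRoot_two {n : ℕ} (hn : 7 ≤ n) :
    ∃ r : ℕ, r.Prime ∧ IsPrimitiveRoot (2 : ZMod r) n := by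
  by_contra hcon
  push Not at hcon
  obtain ⟨A, hA⟩ : ∃ A : ℕ, (A : ℤ) = (Polynomial.cyclotomic n ℤ).eval 2 :=
    ⟨((Polynomial.cyclotomic n ℤ).eval 2).natAbs, by
      have := (Polynomial.cyclotomic_pos (n := n) (by lia) (2 : ℤ)).le
      exact Int.natAbs_of_nonneg this⟩
  have hA1 : 1 < A := by
    have h := Polynomial.sub_one_lt_natAbs_cyclotomic_eval (n := n) (q := 2) (by lia) (by norm_num)
    rw [Nat.cast_ofNat, ← hA] at h
    simpa using h
  have hAmod : ∀ p : ℕ, p ∣ A → (Polynomial.cyclotomic n (ZMod p)).IsRoot 2 := by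
    intro p hpA
    rw [Polynomial.IsRoot, ← Polynomial.map_cyclotomic_int]
    have h1 := Polynomial.eval_intCast_map (Int.castRingHom (ZMod p)) (Polynomial.cyclotomic n ℤ) 2
    rw [Int.cast_id, ← hA] at h1
    have h2 : ((A : ℕ) : ZMod p) = 0 := (ZMod.natCast_eq_zero_iff _ _).2 hpA
    simpa [h2] using h1
  -- structure of a prime divisor
  have hstr : ∀ p : ℕ, p.Prime → p ∣ A → ∃ k m : ℕ, n = p ^ (k + 1) * m ∧ ¬ p ∣ m ∧ m ∣ p - 1 ∧
      IsPrimitiveRoot (2 : ZMod p) m ∧ p ≠ 2 := by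
    intro p hp hpA
    have : Fact p.Prime := ⟨hp⟩
    obtain ⟨k, m, hpm, hnkm⟩ := Nat.exists_eq_pow_mul_and_not_dvd (n := n) (by lia) p hp.ne_one
    have hm0 : (m : ZMod p) ≠ 0 := fun h => hpm ((ZMod.natCast_eq_zero_iff _ _).1 h)
    have : NeZero (m : ZMod p) := ⟨hm0⟩
    have hroot := hAmod p hpA
    rw [hnkm, Polynomial.isRoot_cyclotomic_prime_pow_mul_iff_of_charP] at hroot
    have hmpos : m ≠ 0 := by rintro rfl; simp at hm0
    have hp2 : (2 : ZMod p) ≠ 0 := by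
      intro h
      have := hroot.pow_eq_one
      rw [h, zero_pow hmpos] at this
      exact zero_ne_one this
    rcases k with _ | k
    · exfalso
      refine hcon p hp ?_
      rw [hnkm]; simpa using hroot
    refine ⟨k, m, hnkm, hpm, ?_, hroot, ?_⟩
    · exact hroot.dvd_of_pow_eq_one _ (ZMod.pow_card_sub_one_eq_one hp2)
    · rintro rfl; exact hp2 (ZMod.natCast_self 2)
  obtain ⟨p, hp, hpA⟩ := Nat.exists_prime_and_dvd hA1.ne'
  have : Fact p.Prime := ⟨hp⟩
  obtain ⟨k, m, hnkm, hpm, hmp, hprim, hp2⟩ := hstr p hp hpA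
  have huniq : ∀ {d : ℕ}, d.Prime → d ∣ A → d = p := by
    intro d hd hdA
    by_contra hdp
    obtain ⟨k', m', hnkm', hpm', hmp', -, -⟩ := hstr d hd hdA
    have h1 : d ∣ m := by
      have : d ∣ p ^ (k + 1) * m := by rw [← hnkm, hnkm', pow_succ]; exact ⟨d ^ k' * m', by ring⟩
      rcases (hd.dvd_mul).1 this with h | h
      · exact absurd ((Nat.prime_dvd_prime_iff_eq hd hp).1 (hd.dvd_of_dvd_pow h)) hdp
      · exact h
    have h2 : p ∣ m' := by
      have : p ∣ d ^ (k' + 1) * m' := by rw [← hnkm', hnkm, pow_succ]; exact ⟨p ^ k * m, by ring⟩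
      rcases (hp.dvd_mul).1 this with h | h
      · exact absurd ((Nat.prime_dvd_prime_iff_eq hp hd).1 (hp.dvd_of_dvd_pow h)).symm hdp
      · exact h
    have h3 := Nat.le_of_dvd (by have := hp.two_le; lia) (h1.trans hmp)
    have h4 := Nat.le_of_dvd (by have := hd.two_le; lia) (h2.trans hmp')
    have := hp.two_le; have := hd.two_le
    lia
  have hApow := Nat.eq_prime_pow_of_unique_prime_dvd (by lia : A ≠ 0) huniq
  set j := A.primeFactorsList.length
  set n' := p ^ k * m with hn'
  have hnn' : n = n' * p := by rw [hnkm, hn']; ring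
  have hn'pos : 0 < n' := by rcases Nat.eq_zero_or_pos n' with h | h; · simp [h] at hnn'; lia
                             · exact h
  have hodd : Odd p := hp.odd_of_ne_two hp2
  have hp3 : 3 ≤ p := by have := hp.two_le; lia
  -- `p ^ 2` does not divide `A`
  have hj : j = 1 := by
    have hdiv : (2 ^ n' - 1) * A ∣ 2 ^ n - 1 := by
      have h := Polynomial.X_pow_sub_one_mul_cyclotomic_dvd_X_pow_sub_one_of_dvd ℤ (d := n') (n := n)
        (Nat.mem_properDivisors.2 ⟨⟨p, hnn'⟩, by nlinarith⟩)
      have h' := Polynomial.eval_dvd (x := (2 : ℤ)) h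
      simp only [Polynomial.eval_mul, Polynomial.eval_sub, Polynomial.eval_pow, Polynomial.eval_X,
        Polynomial.eval_one, ← hA] at h'
      have e1 : ((2 ^ n' - 1 : ℕ) : ℤ) = 2 ^ n' - 1 := by
        rw [Nat.cast_sub Nat.one_le_two_pow]; simp
      have e2 : ((2 ^ n - 1 : ℕ) : ℤ) = 2 ^ n - 1 := by
        rw [Nat.cast_sub Nat.one_le_two_pow]; simp
      rw [← e1, ← e2] at h'
      exact_mod_cast h'
    have hpx : p ∣ 2 ^ n' - 1 := by
      rw [← ZMod.natCast_eq_zero_iff, Nat.cast_sub Nat.one_le_two_pow]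
      have : (2 : ZMod p) ^ n' = 1 := by rw [hn', mul_comm, pow_mul, hprim.pow_eq_one, one_pow]
      simp [this]
    have hpn : ¬ p ∣ 2 ^ n' := fun h => hp2 ((Nat.prime_dvd_prime_iff_eq hp Nat.prime_two).1
      (hp.dvd_of_dvd_pow h))
    have h2n' : 1 < 2 ^ n' := Nat.one_lt_two_pow hn'pos.ne'
    have hlte := padicValNat.pow_sub_pow (p := p) (x := 2 ^ n') (y := 1) hodd h2n' hpx hpn
      (n := p) hp.ne_zero
    rw [one_pow, ← pow_mul, ← hnn', padicValNat_self] at hlte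
    have h2n : 1 < 2 ^ n := Nat.one_lt_two_pow (by lia)
    have hle := padicValNat_dvd_iff_le (p := p) (a := 2 ^ n - 1)
      (n := padicValNat p ((2 ^ n' - 1) * A)) (by lia)
    have h3 := hle.1 (pow_padicValNat_dvd.trans hdiv)
    rw [padicValNat.mul (by lia) (by lia), hApow, padicValNat.prime_pow, hlte] at h3
    have : j ≠ 0 := by intro h; rw [h] at hApow; simp at hApow; lia
    lia
  rw [hj, pow_one] at hApow
  have hAR : (Polynomial.cyclotomic n ℝ).eval 2 = p := by
    rw [← Polynomial.map_cyclotomic_int]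
    have h1 := Polynomial.eval_intCast_map (Int.castRingHom ℝ) (Polynomial.cyclotomic n ℤ) 2
    rw [Int.cast_id, ← hA, hApow] at h1
    simpa using h1
  have hbig : p + 1 < 2 ^ p := by
    have : ∀ q : ℕ, 3 ≤ q → q + 1 < 2 ^ q := by
      intro q hq
      induction q, hq using Nat.le_induction with
      | base => norm_num
      | succ q _ ih => rw [pow_succ]; lia
    exact this p hp3
  have h1p : (1 : ℝ) < 2 ^ p := by
    have : (1 : ℕ) < 2 ^ p := by lia
    exact_mod_cast this
  have hlow := Polynomial.sub_one_pow_totient_le_cyclotomic_eval h1p n'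
  have hexp : (Polynomial.cyclotomic n' ℝ).eval (2 ^ p) =
      (Polynomial.expand ℝ p (Polynomial.cyclotomic n' ℝ)).eval 2 := by
    rw [Polynomial.expand_eval]
  have htot : 0 < n'.totient := Nat.totient_pos.2 hn'pos
  by_cases hpn' : p ∣ n'
  · rw [hexp, Polynomial.cyclotomic_expand_eq_cyclotomic hp hpn', ← hnn', hAR] at hlow
    have h5 : (p : ℝ) + 1 < 2 ^ p := by exact_mod_cast hbig
    have h6 : (2 : ℝ) ^ p - 1 ≤ (2 ^ p - 1) ^ n'.totient :=
      le_self_pow₀ (by have : (0 : ℝ) ≤ p := Nat.cast_nonneg p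
                       have : (3 : ℝ) ≤ p := by exact_mod_cast hp3
                       linarith) htot.ne'
    linarith
  · rw [hexp, Polynomial.cyclotomic_expand_eq_cyclotomic_mul hp hpn', ← hnn',
      Polynomial.eval_mul, hAR] at hlow
    have hk : k = 0 := by
      by_contra hk
      exact hpn' ((dvd_pow_self p hk).mul_right m)
    have hnm : n' = m := by rw [hn', hk]; simp
    have hmle := Nat.le_of_dvd (by lia) hmp
    have hp5 : 5 ≤ p := by
      by_contra hlt
      have : p = 3 ∨ p = 4 := by lia
      rcases this with h | h
      · rw [h] at hmle hnn'; lia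
      · rw [h] at hodd; exact absurd hodd (by decide)
    have hup := Polynomial.cyclotomic_eval_le_add_one_pow_totient (one_lt_two (α := ℝ)) n'
    have hbig2 : 3 * p + 1 < 2 ^ p := by
      have : ∀ q : ℕ, 5 ≤ q → 3 * q + 1 < 2 ^ q := by
        intro q hq
        induction q, hq using Nat.le_induction with
        | base => norm_num
        | succ q _ ih => rw [pow_succ]; lia
      exact this p hp5
    have h7 : (3 : ℝ) * p < 2 ^ p - 1 := by
      have : (3 : ℝ) * p + 1 < 2 ^ p := by exact_mod_cast hbig2
      linarith
    have h8 : ((3 : ℝ) * p) ^ n'.totient < (2 ^ p - 1) ^ n'.totient :=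
      pow_lt_pow_left₀ h7 (by positivity) htot.ne'
    have h9 : (p : ℝ) ≤ p ^ n'.totient :=
      le_self_pow₀ (by exact_mod_cast hp.one_lt.le) htot.ne'
    rw [mul_pow] at h8
    have h10 : (2 + 1 : ℝ) = 3 := by norm_num
    rw [h10] at hup
    have h11 : (p : ℝ) * (Polynomial.cyclotomic n' ℝ).eval 2 ≤ p ^ n'.totient * 3 ^ n'.totient := by
      apply mul_le_mul h9 hup (Polynomial.cyclotomic_nonneg _ (by norm_num)) (by positivity)
    linarith

/-- An element of prime order acting on a finite group of order `2 ^ a`, with fixed points counted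
by `2 ^ b`. -/
theorem order_dvd_of_card_fixed {F V : Type*} [Field F] [AddCommGroup V] [Module F V] [Finite V]
    {r e a b : ℕ} [Fact r.Prime] (hr : IsPrimitiveRoot (2 : ZMod r) e)
    (g : V ≃ₗ[F] V) (hg : g ^ r = 1) (W : Submodule F V)
    (hW : ∀ x ∈ W, g x ∈ W) (ha : Nat.card W = 2 ^ a)
    (hb : {x : V | x ∈ W ∧ g x = x}.ncard = 2 ^ b) (hr2 : r ≠ 2) : b ≤ a ∧ e ∣ a - b := by
  have hba : b ≤ a := by
    have h : {x : V | x ∈ W ∧ g x = x}.ncard ≤ (W : Set V).ncard :=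
      Set.ncard_le_ncard (fun x hx => hx.1) (Set.toFinite _)
    have h2 : (W : Set V).ncard = 2 ^ a := by rw [← ha]; rfl
    rw [hb, h2] at h
    exact (Nat.pow_le_pow_iff_right (by norm_num)).1 h
  refine ⟨hba, ?_⟩
  have hz : ∀ h ∈ Subgroup.zpowers g, ∀ x ∈ W, h x ∈ W := by
    intro h hh
    obtain ⟨k, rfl⟩ := (isOfFinOrder_iff_pow_eq_one.2
      ⟨r, (Fact.out : r.Prime).pos, hg⟩).mem_powers_iff_mem_zpowers.2 hh
    intro x hx
    induction k with
    | zero => simpa using hx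
    | succ k ih =>
      have := hW _ (ih ⟨k, by simp⟩)
      simpa [pow_succ'] using this
  let _ : MulAction (Subgroup.zpowers g) W :=
    { smul := fun h x => ⟨h.1 x.1, hz h.1 h.2 x.1 x.2⟩
      one_smul := fun x => Subtype.ext rfl
      mul_smul := fun h h' x => Subtype.ext rfl }
  have hP : IsPGroup r (Subgroup.zpowers g) := by
    refine IsPGroup.of_card_dvd_pow (n := 1) ?_
    rw [Nat.card_zpowers, pow_one]
    exact orderOf_dvd_of_pow_eq_one hg
  have hmod := hP.card_modEq_card_fixedPoints W
  have hfix : Nat.card (MulAction.fixedPoints (Subgroup.zpowers g) W) = 2 ^ b := by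
    rw [← hb, ← Nat.card_coe_set_eq]
    refine Nat.card_congr
      { toFun := fun x => ⟨x.1.1, x.1.2, ?_⟩
        invFun := fun x => ⟨⟨x.1, x.2.1⟩, ?_⟩
        left_inv := fun x => rfl
        right_inv := fun x => rfl }
    · exact congrArg Subtype.val (x.2 ⟨g, Subgroup.mem_zpowers g⟩)
    · rintro ⟨h, hh⟩
      apply Subtype.ext
      change h x.1 = x.1
      obtain ⟨k, rfl⟩ := (isOfFinOrder_iff_pow_eq_one.2
        ⟨r, (Fact.out : r.Prime).pos, hg⟩).mem_powers_iff_mem_zpowers.2 hh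
      have h0 := x.2.2
      clear hh
      induction k with
      | zero => simp
      | succ k ih => 
        have ih' : (g ^ k) x.1 = x.1 := ih
        change (g ^ (k + 1)) x.1 = x.1
        rw [pow_succ, LinearEquiv.mul_apply, h0, ih']
  rw [hfix, ha] at hmod
  have h2 : (2 : ZMod r) ≠ 0 := by
    intro h
    have : ((2 : ℕ) : ZMod r) = 0 := by exact_mod_cast h
    rw [ZMod.natCast_eq_zero_iff] at this
    exact hr2 ((Nat.prime_dvd_prime_iff_eq Fact.out Nat.prime_two).1 this)
  have h3 : (2 : ZMod r) ^ a = 2 ^ b := by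
    have := (ZMod.natCast_eq_natCast_iff _ _ _).2 hmod
    exact_mod_cast this
  apply hr.dvd_of_pow_eq_one
  have h4 : (2 : ZMod r) ^ (a - b) * 2 ^ b = 1 * 2 ^ b := by
    rw [← pow_add, Nat.sub_add_cancel hba, h3, one_mul]
  exact mul_right_cancel₀ (pow_ne_zero _ h2) h4

theorem pseudo_hyperoval_irreducible_transitive_imp_nf_le_four
    {F V : Type*} [Field F] [Fintype F] [AddCommGroup V] [Module F V]
    {f n : ℕ} (hf : 1 ≤ f) (hn : 1 ≤ n)
    (hF : Fintype.card F = 2 ^ f)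
    (hV : Module.finrank F V = 3 * n)
    (O : Set (Submodule F V))
    (hOdim : ∀ U ∈ O, Module.finrank F U = n)
    (hOcard : O.ncard = (2 ^ f) ^ n + 2)
    (hOspan : ∀ U₁ ∈ O, ∀ U₂ ∈ O, ∀ U₃ ∈ O,
      U₁ ≠ U₂ → U₁ ≠ U₃ → U₂ ≠ U₃ → U₁ ⊔ U₂ ⊔ U₃ = ⊤)
    (G : Subgroup (V ≃ₗ[F] V))
    (hirr : ∀ W : Submodule F V,
      (∀ g ∈ G, W.map (g : V ≃ₗ[F] V).toLinearMap = W) → W = ⊥ ∨ W = ⊤)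
    (hstab : ∀ g ∈ G, ∀ U ∈ O, U.map (g : V ≃ₗ[F] V).toLinearMap ∈ O)
    (htrans : ∀ U ∈ O, ∀ U' ∈ O,
      ∃ g ∈ G, U.map (g : V ≃ₗ[F] V).toLinearMap = U') :
    n * f ≤ 4 := by
  by_contra hlt
  push Not at hlt
  have : Module.Finite F V := Module.finite_of_finrank_pos (by lia)
  have : Finite V := Module.finite_of_finite F
  have : Finite (V ≃ₗ[F] V) := Finite.of_injective (fun g => (g : V → V)) DFunLike.coe_injective
  obtain ⟨N, hN⟩ : ∃ N, N = n * f := ⟨_, rfl⟩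
  rw [← hN] at hlt
  have hcardF : Nat.card F = 2 ^ f := by rw [Nat.card_eq_fintype_card, hF]
  have hcardSub : ∀ W : Submodule F V, Nat.card W = 2 ^ (f * Module.finrank F W) := by
    intro W
    rw [Module.natCard_eq_pow_finrank (K := F), hcardF, pow_mul]
  have hcardU : ∀ U ∈ O, Nat.card U = 2 ^ N := by
    intro U hU
    rw [hcardSub, hOdim U hU, hN, mul_comm]
  have hOc : O.ncard = 2 ^ N + 2 := by rw [hOcard, ← pow_mul, hN, mul_comm]
  obtain ⟨r, hrp, hr⟩ := exists_prime_isPrimitiveRoot_two (n := 2 * (N - 1)) (by lia)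
  have : Fact r.Prime := ⟨hrp⟩
  have hr2 : r ≠ 2 := by
    rintro rfl
    have h := hr.pow_eq_one
    rw [show (2 : ZMod 2) = 0 from ZMod.natCast_self 2, zero_pow (by lia)] at h
    exact zero_ne_one h
  have hr3 : 3 ≤ r := by have := hrp.two_le; lia
  -- `r` divides the size of `O`
  have hrO : r ∣ O.ncard := by
    have h1 : ((2 : ZMod r) ^ (N - 1) - 1) * (2 ^ (N - 1) + 1) = 0 := by
      have := hr.pow_eq_one
      rw [mul_comm, pow_mul] at this
      linear_combination this
    have h2 : (2 : ZMod r) ^ (N - 1) ≠ 1 := by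
      intro h
      have := Nat.le_of_dvd (by lia) (hr.dvd_of_pow_eq_one _ h)
      lia
    have h3 : (2 : ZMod r) ^ (N - 1) + 1 = 0 :=
      (mul_eq_zero.1 h1).resolve_left (sub_ne_zero.2 h2)
    rw [← ZMod.natCast_eq_zero_iff, hOc]
    have h4 : 2 ^ N = 2 * 2 ^ (N - 1) := by rw [← pow_succ']; congr 1; lia
    rw [h4]; push_cast
    linear_combination 2 * h3
  have hOfin : O.Finite := Set.finite_of_ncard_ne_zero (by lia)
  obtain ⟨U0, hU0⟩ : O.Nonempty := Set.nonempty_of_ncard_ne_zero (by lia)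
  let _ : MulAction G (Submodule F V) :=
    { smul := fun g U => U.map (g.1 : V ≃ₗ[F] V).toLinearMap
      one_smul := fun U => Submodule.map_id U
      mul_smul := fun g h U => Submodule.map_comp _ _ U }
  have horb : MulAction.orbit G U0 = O := by
    ext U
    constructor
    · rintro ⟨g, rfl⟩
      exact hstab g.1 g.2 U0 hU0
    · intro hU
      obtain ⟨g, hg, h⟩ := htrans U0 hU0 U hU
      exact ⟨⟨g, hg⟩, h⟩
  have hrG : r ∣ Nat.card G := by
    refine hrO.trans ?_
    rw [← horb, ← MulAction.index_stabilizer]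
    exact Subgroup.index_dvd_card _
  obtain ⟨g', hg'⟩ := exists_prime_orderOf_dvd_card' (G := G) r hrG
  obtain ⟨g, hgG⟩ := g'
  have hord : orderOf g = r := by rw [← hg', Subgroup.orderOf_mk]
  have hgr : g ^ r = 1 := by rw [← hord]; exact pow_orderOf_eq_one g
  have hg1 : g ≠ 1 := by
    rintro rfl
    rw [orderOf_one] at hord; lia
  -- fixed space
  obtain ⟨C, hC⟩ : ∃ C : Submodule F V, ∀ x, x ∈ C ↔ g x = x :=
    ⟨LinearMap.eqLocus g.toLinearMap LinearMap.id, fun x => Iff.rfl⟩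
  have hfixcard : ∀ W : Submodule F V, {x : V | x ∈ W ∧ g x = x}.ncard =
      2 ^ (f * Module.finrank F (W ⊓ C : Submodule F V)) := by
    intro W
    rw [← hcardSub]
    have : {x : V | x ∈ W ∧ g x = x} = ((W ⊓ C : Submodule F V) : Set V) := by
      ext x; simp [hC]
    rw [this]; rfl
  -- members fixed by `g` are fixed pointwise
  have hfixU : ∀ U ∈ O, U.map g.toLinearMap = U → U ≤ C := by
    intro U hU hgU
    obtain ⟨h1, h2⟩ := order_dvd_of_card_fixed hr g hgr U
      (fun x hx => by rw [← hgU]; exact Submodule.mem_map_of_mem hx) (hcardU U hU)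
      (hfixcard U) hr2
    have h3 : N - f * Module.finrank F (U ⊓ C : Submodule F V) = 0 :=
      Nat.eq_zero_of_dvd_of_lt h2 (by lia)
    have h4 : f * Module.finrank F (U ⊓ C : Submodule F V) = f * n := by
      rw [mul_comm f n, ← hN]; lia
    have h5 := Nat.eq_of_mul_eq_mul_left (by lia) h4
    have h6 : U ⊓ C = U := Submodule.eq_of_le_of_finrank_eq inf_le_left
      (by rw [h5, hOdim U hU])
    exact inf_eq_left.1 h6
  -- some member is moved
  obtain ⟨U, hU, hmov⟩ : ∃ U ∈ O, U.map g.toLinearMap ≠ U := by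
    by_contra hno
    push Not at hno
    obtain ⟨A, B, D, hA, hB, hD, hAB, hAD, hBD⟩ :=
      (Set.two_lt_ncard_iff hOfin).1 (by have := Nat.one_le_two_pow (n := N); lia : 2 < O.ncard)
    have htop : (⊤ : Submodule F V) ≤ C := by
      rw [← hOspan A hA B hB D hD hAB hAD hBD]
      exact sup_le (sup_le (hfixU A hA (hno A hA)) (hfixU B hB (hno B hB))) (hfixU D hD (hno D hD))
    apply hg1
    ext x
    exact (hC x).1 (htop trivial)
  set U1 := U.map g.toLinearMap with hU1
  set U2 := U1.map g.toLinearMap with hU2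
  have hU1O : U1 ∈ O := hstab g hgG U hU
  have hU2O : U2 ∈ O := hstab g hgG U1 hU1O
  have hinj : Function.Injective (fun W : Submodule F V => W.map g.toLinearMap) :=
    Submodule.map_injective_of_injective g.injective
  have h12 : U1 ≠ U2 := by
    intro h
    exact hmov (hinj h).symm
  have h02 : U ≠ U2 := by
    intro h
    -- `g ^ 2` and `g ^ r` fix `U`, hence so does `g`
    let γ : G := ⟨g, hgG⟩
    have hs1 : ∀ W : Submodule F V, γ • W = W.map g.toLinearMap := fun W => rfl
    have hs2 : γ ^ 2 ∈ MulAction.stabilizer G U := by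
      rw [MulAction.mem_stabilizer_iff, pow_two, mul_smul, hs1, hs1]
      exact h.symm
    have hs3 : γ ^ r = 1 := Subtype.ext hgr
    obtain ⟨k, hk⟩ := hrp.odd_of_ne_two hr2
    have hs4 : γ = ((γ ^ 2) ^ k)⁻¹ := by
      rw [eq_inv_iff_mul_eq_one, ← pow_mul, ← pow_succ', ← hk, hs3]
    have hs5 : γ ∈ MulAction.stabilizer G U := by
      rw [hs4]; exact inv_mem (pow_mem hs2 k)
    exact hmov (MulAction.mem_stabilizer_iff.1 hs5)
  have hspan := hOspan U hU U1 hU1O U2 hU2O (Ne.symm hmov) h02 h12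
  -- directness
  have hd01 := Submodule.finrank_sup_add_finrank_inf_eq U U1
  have hd012 := Submodule.finrank_sup_add_finrank_inf_eq (U ⊔ U1) U2
  rw [hspan, finrank_top, hV, hOdim _ hU2O] at hd012
  rw [hOdim _ hU, hOdim _ hU1O] at hd01
  have hi01 : U ⊓ U1 = ⊥ := Submodule.finrank_eq_zero.1 (by lia)
  have hi012 : (U ⊔ U1) ⊓ U2 = ⊥ := Submodule.finrank_eq_zero.1 (by lia)
  have hCU : C ⊓ (U ⊔ U1) = ⊥ := by
    rw [eq_bot_iff]
    rintro x ⟨hxC, hx⟩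
    have hgx := (hC x).1 hxC
    obtain ⟨a, ha, b, hb, rfl⟩ := Submodule.mem_sup.1 hx
    have hga : g a ∈ U1 := Submodule.mem_map_of_mem ha
    have hgb : g b ∈ U2 := Submodule.mem_map_of_mem hb
    rw [map_add] at hgx
    have hgb0 : g b = 0 := by
      have : g b ∈ (U ⊔ U1) ⊓ U2 := by
        refine ⟨?_, hgb⟩
        have e : g b = (a + b) - g a := by rw [← hgx]; abel
        rw [e]
        exact sub_mem hx (Submodule.mem_sup_right hga)
      rwa [hi012, Submodule.mem_bot] at this
    have hb0 : b = 0 := by simpa using hgb0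
    subst hb0
    have ha0 : a ∈ U ⊓ U1 := ⟨ha, by
      have e : g a = a := by simpa using hgx
      rwa [e] at hga⟩
    rw [hi01] at ha0
    simpa using ha0
  have hdC := Submodule.finrank_sup_add_finrank_inf_eq C (U ⊔ U1)
  rw [hCU, finrank_bot] at hdC
  have hle := Submodule.finrank_le (C ⊔ (U ⊔ U1))
  have hcn : Module.finrank F C ≤ n := by
    rw [hi01, finrank_bot] at hd01; lia
  obtain ⟨h1, q, h2⟩ := order_dvd_of_card_fixed hr g hgr ⊤ (fun x hx => trivial)
    (hcardSub ⊤) (hfixcard ⊤) hr2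
  rw [top_inf_eq, finrank_top, hV] at h2
  have h3 : f * Module.finrank F C ≤ N := by
    rw [hN, mul_comm n f]; exact Nat.mul_le_mul_left f hcn
  have h4 : f * (3 * n) = 3 * N := by rw [hN]; ring
  rw [h4] at h2
  rcases q with _ | _ | q
  · simp at h2; lia
  · simp at h2; lia
  · have : 2 * (N - 1) * (q + 1 + 1) ≥ 2 * (N - 1) * 2 := Nat.mul_le_mul_left _ (by lia)
    lia
end

section
/- Let E be a finite field with |E| = 16 and let V = E³ be regarded as a vector space over the prime field 𝔽₂ by restriction of scalars. Let O be the pseudo-hyperconic, i.e. the set of 𝔽₂-subspaces of V underlying the hyperconic of PG(2,16): O consists of the E-spans E·(1,t,t²) for t ∈ E together with E·(0,1,0) and E·(0,0,1), each regarded as an 𝔽₂-subspace of V. Then the stabiliser of O in the group of 𝔽₂-linear automorphisms of V is not transitive on O: there exist U, U' ∈ O such that no 𝔽₂-linear automorphism g of V satisfies both (Submodule.map g U'' ∈ O for every U'' ∈ O) and Submodule.map g U = U'. -/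
/-- The pseudo-hyperconic: the set of `𝔽₂`-subspaces of `V = E³` underlying the hyperconic
(regular hyperoval) `{E·(1,t,t²) : t ∈ E} ∪ {E·(0,1,0), E·(0,0,1)}` of `PG(2,E)`. -/
def pseudoHyperconic (E : Type*) [Field E] [Algebra (ZMod 2) E] :
    Set (Submodule (ZMod 2) (Fin 3 → E)) :=
  {W | (∃ t : E, W = (Submodule.span E
          ({![1, t, t ^ 2]} : Set (Fin 3 → E))).restrictScalars (ZMod 2)) ∨
    W = (Submodule.span E ({![0, 1, 0]} : Set (Fin 3 → E))).restrictScalars (ZMod 2) ∨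
    W = (Submodule.span E ({![0, 0, 1]} : Set (Fin 3 → E))).restrictScalars (ZMod 2)}

/-- Additive maps preserving lines, with image of rank at least two, are semilinear. -/
theorem PH_semilinear {E V Q : Type*} [Field E] [AddCommGroup V] [Module E V]
    [AddCommGroup Q] [Module E Q] (h : V →+ Q)
    (H : ∀ (c : E) (v : V), ∃ d : E, h (c • v) = d • h v)
    (v w : V) (hvw : LinearIndependent E ![h v, h w]) :
    ∃ σ : E →+* E, ∀ (c : E) (x : V), h (c • x) = σ c • h x := by
  choose s hs using H
  have key : ∀ x y : V, LinearIndependent E ![h x, h y] → ∀ c, s c x = s c y := by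
    intro x y hxy c
    have h1 := hs c (x + y)
    rw [smul_add, map_add, map_add, hs c x, hs c y, smul_add] at h1
    rw [LinearIndependent.pair_iff] at hxy
    have h2 := hxy (s c x - s c (x + y)) (s c y - s c (x + y)) (by
      rw [sub_smul, sub_smul]
      rw [← sub_eq_zero] at h1
      rw [← h1]; abel)
    rw [sub_eq_zero.1 h2.1, sub_eq_zero.1 h2.2]
  have hv0 : h v ≠ 0 := hvw.ne_zero 0
  have hw0 : h w ≠ 0 := hvw.ne_zero 1
  have main : ∀ (c : E) (x : V), h (c • x) = s c v • h x := by
    intro c x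
    by_cases hx : h x = 0
    · rw [hs, hx, smul_zero, smul_zero]
    · by_cases hi : LinearIndependent E ![h v, h x]
      · rw [hs, key v x hi]
      · have hi2 : LinearIndependent E ![h w, h x] := by
          rw [LinearIndependent.pair_iff' hv0] at hi
          push Not at hi
          obtain ⟨a, ha⟩ := hi
          rw [LinearIndependent.pair_iff' hw0]
          intro b hb
          have h3 := LinearIndependent.pair_iff.1 hvw a (-b) (by rw [ha, neg_smul, hb]; abel)
          apply hx
          rw [← ha, h3.1, zero_smul]
        rw [hs, key v w hvw, key w x hi2]
  have inj : ∀ a b : E, a • h v = b • h v → a = b := fun a b hab =>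
    smul_left_injective E hv0 hab
  refine ⟨⟨⟨⟨fun c => s c v, ?_⟩, ?_⟩, ?_, ?_⟩, main⟩
  · apply inj; rw [← main, one_smul, one_smul]
  · intro a b
    apply inj
    show s (a * b) v • h v = (s a v * s b v) • h v
    rw [← main, mul_smul, main, main, mul_smul]
  · apply inj
    show s 0 v • h v = (0 : E) • h v
    rw [← main, zero_smul, zero_smul, map_zero]
  · intro a b
    apply inj
    show s (a + b) v • h v = (s a v + s b v) • h v
    rw [← main, add_smul, map_add, main, main, add_smul]

theorem PH_mem {E : Type*} [Field E] [Algebra (ZMod 2) E]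
    {W : Submodule (ZMod 2) (Fin 3 → E)} (hW : W ∈ pseudoHyperconic E) :
    ∃ w : Fin 3 → E, w ≠ 0 ∧ W = (Submodule.span E {w}).restrictScalars (ZMod 2) ∧
      (w 1 ^ 2 = w 0 * w 2 ∨ w 0 = 0) := by
  rcases hW with ⟨t, rfl⟩ | rfl | rfl
  · refine ⟨_, ?_, rfl, ?_⟩
    · intro h; simpa using congrFun h 0
    · simp
  · refine ⟨_, ?_, rfl, ?_⟩
    · intro h; simpa using congrFun h 1
    · simp
  · refine ⟨_, ?_, rfl, ?_⟩
    · intro h; simpa using congrFun h 2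
    · simp

theorem PH_cover {E : Type*} [Field E] [CharP E 2] (s : E) (v : Fin 3 → E) :
    ∃ (a b : E) (x : Fin 3 → E), v = a • ![1, s, s ^ 2] + b • x ∧
      ((∃ t, x = ![1, t, t ^ 2]) ∨ x = ![0, 1, 0] ∨ x = ![0, 0, 1]) := by
  have h2 : (2 : E) = 0 := CharTwo.two_eq_zero
  by_cases hY : v 1 - v 0 * s = 0
  · refine ⟨v 0, v 2 - v 0 * s ^ 2, ![0, 0, 1], ?_, by simp⟩
    ext i; fin_cases i <;> simp
    linear_combination hY
  by_cases hZ : v 2 - v 0 * s ^ 2 = 0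
  · refine ⟨v 0, v 1 - v 0 * s, ![0, 1, 0], ?_, by simp⟩
    ext i; fin_cases i <;> simp
    linear_combination hZ
  obtain ⟨Y, hYd⟩ : ∃ Y, Y = v 1 - v 0 * s := ⟨_, rfl⟩
  obtain ⟨Z, hZd⟩ : ∃ Z, Z = v 2 - v 0 * s ^ 2 := ⟨_, rfl⟩
  rw [← hYd] at hY
  rw [← hZd] at hZ
  refine ⟨v 0 - Y ^ 2 / Z, Y ^ 2 / Z, _, ?_, Or.inl ⟨s + Z / Y, rfl⟩⟩
  ext i; fin_cases i <;> simp
  · field_simp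
    linear_combination (-Z) * hYd
  · field_simp
    linear_combination (-Z) * hZd - s * Y * Z * h2

theorem PH_poly {E : Type*} [Field E] [Fintype E] (hE : Fintype.card E = 16)
    (a0 a1 a2 c0 c1 c2 β : E) (hβ : β ≠ 0)
    (H : ∀ s : E, (a1 + s ^ 2 * c1) ^ 2 = (a0 + s ^ 2 * c0) * (a2 + s * β + s ^ 2 * c2) ∨
      a0 + s ^ 2 * c0 = 0) : a0 = 0 ∧ c0 = 0 := by
  open Polynomial in
  let q : E[X] := C a0 + X ^ 2 * C c0
  let p : E[X] := (C a1 + X ^ 2 * C c1) ^ 2 - q * (C a2 + X * C β + X ^ 2 * C c2)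
  have hpq : p * q = 0 := by
    apply Polynomial.eq_zero_of_natDegree_lt_card_of_eval_eq_zero (p * q)
      (f := (id : E → E)) Function.injective_id
    · intro s
      simp only [id, p, q, Polynomial.eval_mul, Polynomial.eval_sub, Polynomial.eval_add,
        Polynomial.eval_pow, Polynomial.eval_C, Polynomial.eval_X]
      rcases H s with h | h
      · rw [h]; ring
      · rw [h]; ring
    · rw [hE]
      have : (p * q).natDegree ≤ 6 := by
        simp only [p, q]; compute_degree
      omega
  rcases mul_eq_zero.1 hpq with h | h
  · have e : p = Polynomial.C (a1 ^ 2 - a0 * a2) + Polynomial.C (- (a0 * β)) * Polynomial.X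
        + Polynomial.C (2 * a1 * c1 - a0 * c2 - c0 * a2) * Polynomial.X ^ 2
        + Polynomial.C (- (c0 * β)) * Polynomial.X ^ 3
        + Polynomial.C (c1 ^ 2 - c0 * c2) * Polynomial.X ^ 4 := by
      simp only [p, q, map_sub, map_mul, map_neg, map_pow, map_ofNat]
      ring
    rw [h] at e
    have h1 := congrArg (fun r => Polynomial.coeff r 1) e
    have h3 := congrArg (fun r => Polynomial.coeff r 3) e
    simp [Polynomial.coeff_C, Polynomial.coeff_X_pow, -map_neg, -map_sub,
      -map_mul, hβ] at h1 h3
    exact ⟨by simpa [hβ] using h1, by simpa [hβ] using h3⟩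
  · have h1 := congrArg (fun r => Polynomial.coeff r 0) h
    have h3 := congrArg (fun r => Polynomial.coeff r 2) h
    simp [q, Polynomial.coeff_C] at h1 h3
    exact ⟨h1, h3⟩

theorem PH_local {E : Type*} [Field E] [Fintype E] [Algebra (ZMod 2) E] [CharP E 2]
    (g : (Fin 3 → E) ≃ₗ[ZMod 2] (Fin 3 → E))
    (hg : ∀ U'' ∈ pseudoHyperconic E, Submodule.map g.toLinearMap U'' ∈ pseudoHyperconic E)
    (s : E) : ∃ σ : E →ₐ[ZMod 2] E, ∀ (c : E) (v : Fin 3 → E),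
      ∃ d : E, g (c • v) - σ c • g v = g (d • ![1, s, s ^ 2]) := by
  have line : ∀ u : Fin 3 → E, (Submodule.span E {u}).restrictScalars (ZMod 2) ∈
      pseudoHyperconic E → ∃ w : Fin 3 → E, w ≠ 0 ∧
        (∀ y, y ∈ Submodule.span E {w} ↔ ∃ c : E, g (c • u) = y) := by
    intro u hu
    obtain ⟨w, hw, he, -⟩ := PH_mem (hg _ hu)
    refine ⟨w, hw, fun y => ?_⟩
    have := SetLike.ext_iff.1 he y
    rw [Submodule.restrictScalars_mem] at this
    rw [← this]
    simp [Submodule.mem_span_singleton, LinearEquiv.eq_symm_apply]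
  obtain ⟨w, hw, hL⟩ := line ![1, s, s ^ 2] (Or.inl ⟨s, rfl⟩)
  set L := Submodule.span E {w} with hLd
  let h : (Fin 3 → E) →+ ((Fin 3 → E) ⧸ L) :=
    L.mkQ.toAddMonoidHom.comp g.toLinearMap.toAddMonoidHom
  have hh : ∀ x, h x = L.mkQ (g x) := fun x => rfl
  have h0 : ∀ a : E, h (a • ![1, s, s ^ 2]) = 0 := by
    intro a
    rw [hh, Submodule.mkQ_apply, Submodule.Quotient.mk_eq_zero, hL]
    exact ⟨a, rfl⟩
  have H : ∀ (c : E) (v : Fin 3 → E), ∃ d : E, h (c • v) = d • h v := by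
    intro c v
    obtain ⟨a, b, x, hv, hx⟩ := PH_cover s v
    have hxO : (Submodule.span E {x}).restrictScalars (ZMod 2) ∈ pseudoHyperconic E := by
      rcases hx with ⟨t, rfl⟩ | rfl | rfl
      · exact Or.inl ⟨t, rfl⟩
      · exact Or.inr (Or.inl rfl)
      · exact Or.inr (Or.inr rfl)
    obtain ⟨w', hw', hL'⟩ := line x hxO
    have e1 : h v = h (b • x) := by rw [hv, map_add, h0, zero_add]
    have e2 : h (c • v) = h (c • b • x) := by
      rw [hv, smul_add, map_add, smul_smul, h0, zero_add]
    rw [e1, e2]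
    by_cases hb : b • x = 0
    · exact ⟨0, by rw [hb]; simp⟩
    obtain ⟨p, hp⟩ := Submodule.mem_span_singleton.1 ((hL' _).2 ⟨b, rfl⟩)
    obtain ⟨r, hr⟩ := Submodule.mem_span_singleton.1 ((hL' _).2 ⟨c * b, rfl⟩)
    have hp0 : p ≠ 0 := by
      rintro rfl
      rw [zero_smul] at hp
      exact hb (g.map_eq_zero_iff.1 hp.symm)
    refine ⟨r / p, ?_⟩
    rw [hh, hh, ← hp, smul_smul, ← hr, ← map_smul, smul_smul, div_mul_cancel₀ _ hp0]
  have hsurj : Function.Surjective h := fun y => by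
    obtain ⟨z, rfl⟩ := L.mkQ_surjective y
    exact ⟨g.symm z, by rw [hh, g.apply_symm_apply]⟩
  have hfr : Module.finrank E ((Fin 3 → E) ⧸ L) = 2 := by
    rw [Submodule.finrank_quotient, hLd, finrank_span_singleton hw]; simp
  let B := Module.finBasisOfFinrankEq E _ hfr
  obtain ⟨v1, hv1⟩ := hsurj (B 0)
  obtain ⟨v2, hv2⟩ := hsurj (B 1)
  have hli : LinearIndependent E ![h v1, h v2] := by
    convert B.linearIndependent using 1
    ext i; fin_cases i <;> simp [hv1, hv2]
  obtain ⟨σ, hσ⟩ := PH_semilinear h H v1 v2 hli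
  refine ⟨{ σ with commutes' := fun r => ?_ }, fun c v => ?_⟩
  · exact RingHom.congr_fun (Subsingleton.elim (σ.comp (algebraMap (ZMod 2) E))
      (algebraMap (ZMod 2) E)) r
  · have h1 := hσ c v
    rw [hh, hh, ← map_smul, ← sub_eq_zero, ← map_sub, Submodule.mkQ_apply,
      Submodule.Quotient.mk_eq_zero, hL] at h1
    obtain ⟨d, hd⟩ := h1
    exact ⟨d, hd.symm⟩

theorem PH_global {E : Type*} [Field E] [Fintype E] [Algebra (ZMod 2) E] [CharP E 2]
    (hE : Fintype.card E = 16)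
    (g : (Fin 3 → E) ≃ₗ[ZMod 2] (Fin 3 → E))
    (hg : ∀ U'' ∈ pseudoHyperconic E, Submodule.map g.toLinearMap U'' ∈ pseudoHyperconic E) :
    ∃ σ : E →ₐ[ZMod 2] E, ∀ (c : E) (v : Fin 3 → E), g (c • v) = σ c • g v := by
  choose σ hσ using PH_local g hg
  have hfin : Module.finrank (ZMod 2) E = 4 := by
    have := Module.card_eq_pow_finrank (K := ZMod 2) (V := E)
    rw [hE, ZMod.card] at this
    exact (Nat.pow_right_injective le_rfl (by simpa using this.symm : (2:ℕ) ^ _ = 2 ^ 4))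
  have hcard : Fintype.card (E →ₐ[ZMod 2] E) < Fintype.card E := by
    have := AlgHom.card_le (F := ZMod 2) (K := E)
    omega
  obtain ⟨s, t, hst, he⟩ := Fintype.exists_ne_map_eq_of_card_lt σ hcard
  refine ⟨σ s, fun c v => ?_⟩
  obtain ⟨d, hd⟩ := hσ s c v
  obtain ⟨d', hd'⟩ := hσ t c v
  rw [← he, hd] at hd'
  have h1 := g.injective hd'
  have e0 := congrFun h1 0
  have e1 := congrFun h1 1
  simp only [Pi.smul_apply, smul_eq_mul, Matrix.cons_val_zero, Matrix.cons_val_one, mul_one]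
    at e0 e1
  rw [← e0, mul_eq_mul_left_iff] at e1
  have hd0 : d = 0 := by
    rcases e1 with h | h
    · exact absurd h hst
    · exact h
  rw [hd0, zero_smul, map_zero] at hd
  exact sub_eq_zero.1 hd

/-- **Proposition (case `|E| = 16`).** The stabiliser of the pseudo-hyperconic of
`PG(11,2)` (obtained by field reduction of the hyperconic of `PG(2,16)`) in the group of
`𝔽₂`-linear automorphisms of `E³` is *not* transitive on the pseudo-hyperconic. -/
theorem pseudoHyperconic_card_sixteen_not_transitive
    {E : Type*} [Field E] [Fintype E] [Algebra (ZMod 2) E]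
    (hE : Fintype.card E = 16) :
    ∃ U ∈ pseudoHyperconic E, ∃ U' ∈ pseudoHyperconic E,
      ¬ ∃ g : (Fin 3 → E) ≃ₗ[ZMod 2] (Fin 3 → E),
        (∀ U'' ∈ pseudoHyperconic E,
          Submodule.map g.toLinearMap U'' ∈ pseudoHyperconic E) ∧
        Submodule.map g.toLinearMap U = U' := by
  have : CharP E 2 := charP_of_injective_algebraMap (algebraMap (ZMod 2) E).injective 2
  refine ⟨_, Or.inr (Or.inl rfl), _, Or.inr (Or.inr rfl), ?_⟩
  rintro ⟨g, hg, hN⟩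
  obtain ⟨σ, hσ⟩ := PH_global hE g hg
  have hb : g ![0, 1, 0] ∈ (Submodule.span E ({![0, 0, 1]} : Set (Fin 3 → E))).restrictScalars
      (ZMod 2) := by
    rw [← hN]
    exact ⟨_, Submodule.mem_span_singleton_self _, rfl⟩
  rw [Submodule.restrictScalars_mem, Submodule.mem_span_singleton] at hb
  obtain ⟨β, hβ⟩ := hb
  have hβ0 : β ≠ 0 := by
    rintro rfl
    rw [zero_smul] at hβ
    have := congrFun (g.map_eq_zero_iff.1 hβ.symm) 1
    simp at this
  have hσs : Function.Surjective σ := Finite.surjective_of_injective σ.toRingHom.injective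
  have hdec : ∀ x y z : E, g ![x, y, z] =
      σ x • g ![1, 0, 0] + σ y • g ![0, 1, 0] + σ z • g ![0, 0, 1] := by
    intro x y z
    rw [← hσ, ← hσ, ← hσ, ← map_add, ← map_add]
    congr 1
    ext i; fin_cases i <;> simp
  obtain ⟨a, ha⟩ : ∃ a, a = g ![1, 0, 0] := ⟨_, rfl⟩
  obtain ⟨c, hc⟩ : ∃ c, c = g ![0, 0, 1] := ⟨_, rfl⟩
  rw [← ha, ← hc, ← hβ] at hdec
  have H := PH_poly hE (a 0) (a 1) (a 2) (c 0) (c 1) (c 2) β hβ0 (by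
    intro s
    obtain ⟨t, rfl⟩ := hσs s
    obtain ⟨w, hw, he, hor⟩ := PH_mem (hg _ (Or.inl ⟨t, rfl⟩))
    have hm : g ![1, t, t ^ 2] ∈ (Submodule.span E {w}).restrictScalars (ZMod 2) := by
      rw [← he]
      exact ⟨_, Submodule.mem_span_singleton_self _, rfl⟩
    rw [Submodule.restrictScalars_mem, Submodule.mem_span_singleton, hdec] at hm
    obtain ⟨k, hk⟩ := hm
    have k0 := congrFun hk 0
    have k1 := congrFun hk 1
    have k2 := congrFun hk 2
    simp only [Pi.add_apply, Pi.smul_apply, smul_eq_mul] at k0 k1 k2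
    simp at k0 k1 k2
    rw [← k0, ← k1, ← k2]
    rcases hor with h | h
    · left; linear_combination k ^ 2 * h
    · right; rw [h, mul_zero])
  obtain ⟨v, hv⟩ := g.surjective ![1, 0, 0]
  have hv3 : v = ![v 0, v 1, v 2] := by ext i; fin_cases i <;> rfl
  rw [hv3, hdec] at hv
  have := congrFun hv 0
  simp only [Pi.add_apply, Pi.smul_apply, smul_eq_mul, H.1, H.2] at this
  simp at this
end

section
/- Let V be a 6-dimensional vector space over the field 𝔽₂ with two elements. If O₁ and O₂ are pseudo-hyperovals of V (sets of six 2-dimensional 𝔽₂-subspaces of V such that any three distinct members span V), then there exists an 𝔽₂-linear automorphism g of V with {Submodule.map g U : U ∈ O₁} = O₂; that is, the pseudo-hyperoval of PG(5,2) is unique up to linear equivalence. -/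
open Module in
/-- Members of a spanning triple are independent. -/
lemma ph_trip {V : Type*} [AddCommGroup V] [Module (ZMod 2) V]
    (hV : finrank (ZMod 2) V = 6) (A B C : Submodule (ZMod 2) V)
    (hA : finrank (ZMod 2) A = 2) (hB : finrank (ZMod 2) B = 2) (hC : finrank (ZMod 2) C = 2)
    (h : A ⊔ B ⊔ C = ⊤) : ∀ x ∈ A, ∀ y ∈ B, ∀ z ∈ C, x + y = z → z = 0 := by
  intro x hx y hy z hz e
  have : FiniteDimensional (ZMod 2) V := FiniteDimensional.of_finrank_pos (by omega)
  have h1 := Submodule.finrank_sup_add_finrank_inf_eq (A ⊔ B) C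
  have h2 := Submodule.finrank_add_le_finrank_add_finrank A B
  rw [h, finrank_top, hV] at h1
  have h3 : finrank (ZMod 2) ((A ⊔ B) ⊓ C : Submodule (ZMod 2) V) = 0 := by omega
  rw [Submodule.finrank_eq_zero] at h3
  have h4 : z ∈ (A ⊔ B) ⊓ C := ⟨e ▸ Submodule.add_mem_sup hx hy, hz⟩
  rw [h3] at h4
  simpa using h4

open Module in
/-- A subspace of a member that still completes two others to a spanning triple is the member. -/
lemma ph_full {V : Type*} [AddCommGroup V] [Module (ZMod 2) V]
    (hV : finrank (ZMod 2) V = 6) (A B C X : Submodule (ZMod 2) V)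
    (hA : finrank (ZMod 2) A = 2) (hB : finrank (ZMod 2) B = 2) (hC : finrank (ZMod 2) C = 2)
    (hX : X ≤ A) (h : X ⊔ B ⊔ C = ⊤) : X = A := by
  have : FiniteDimensional (ZMod 2) V := FiniteDimensional.of_finrank_pos (by omega)
  have h1 := Submodule.finrank_add_le_finrank_add_finrank (X ⊔ B) C
  have h2 := Submodule.finrank_add_le_finrank_add_finrank X B
  rw [h, finrank_top, hV] at h1
  exact Submodule.eq_of_le_of_finrank_le hX (by omega)

lemma ph_pair {V : Type*} [AddCommGroup V] [Module (ZMod 2) V] {u v z : V}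
    (h : z ∈ Submodule.span (ZMod 2) {u, v}) : z = 0 ∨ z = u ∨ z = v ∨ z = u + v := by
  obtain ⟨a, b, rfl⟩ := Submodule.mem_span_pair.1 h
  have hz : ∀ a : ZMod 2, a = 0 ∨ a = 1 := by decide
  rcases hz a with rfl | rfl <;> rcases hz b with rfl | rfl <;> simp

lemma ph_step {V : Type*} [AddCommGroup V] [Module (ZMod 2) V]
    (A B C D E : Submodule (ZMod 2) V)
    (hACE : ∀ x ∈ A, ∀ y ∈ C, ∀ z ∈ E, x + y = z → z = 0)
    (hCDE : ∀ x ∈ C, ∀ y ∈ D, ∀ z ∈ E, x + y = z → z = 0)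
    {u1 v1 u2 v2 u3 v3 s2 s3 t2 t3 p q : V}
    (hB : B = Submodule.span (ZMod 2) {u2, v2})
    (hu1 : u1 ∈ A) (hv1 : v1 ∈ A) (hu3 : u3 ∈ C) (hv3 : v3 ∈ C)
    (hs2 : s2 ∈ B) (ht2 : t2 ∈ B) (hs3 : s3 ∈ C) (ht3 : t3 ∈ C)
    (hu : u1 + u2 + u3 ∈ D) (hv : v1 + v2 + v3 ∈ D) (hp : p ∈ E) (hq : q ∈ E)
    (ep : p = u1 + s2 + s3) (eq : q = v1 + t2 + t3)
    (hp0 : p ≠ 0) (hq0 : q ≠ 0) (hpq : p + q ≠ 0) :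
    (s2 = v2 ∧ t2 = u2 + v2) ∨ (s2 = u2 + v2 ∧ t2 = u2) := by
  have hh : ∀ x : V, x + x = 0 := fun x => by
    rw [← two_smul (ZMod 2) x]
    have : (2 : ZMod 2) = 0 := rfl
    simp [this]
  have a1 : s2 ≠ 0 := fun h => hp0 (hACE u1 hu1 s3 hs3 p hp (by rw [ep, h]; abel))
  have a2 : s2 ≠ u2 := fun h => hp0 (hCDE (s3 - u3) (sub_mem hs3 hu3) _ hu p hp
    (by rw [ep, h]; abel))
  have a3 : t2 ≠ 0 := fun h => hq0 (hACE v1 hv1 t3 ht3 q hq (by rw [eq, h]; abel))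
  have a4 : t2 ≠ v2 := fun h => hq0 (hCDE (t3 - v3) (sub_mem ht3 hv3) _ hv q hq
    (by rw [eq, h]; abel))
  have a5 : s2 + t2 ≠ 0 := fun h => hpq (hACE (u1 + v1) (add_mem hu1 hv1) (s3 + t3)
    (add_mem hs3 ht3) _ (add_mem hp hq) (by
      have : p + q = u1 + v1 + (s2 + t2) + (s3 + t3) := by rw [ep, eq]; abel
      rw [this, h]; abel))
  have a6 : s2 + t2 ≠ u2 + v2 := fun h => hpq (hCDE (s3 + t3 - (u3 + v3))
    (sub_mem (add_mem hs3 ht3) (add_mem hu3 hv3)) _ (add_mem hu hv) _ (add_mem hp hq) (by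
      have : p + q = u1 + v1 + (s2 + t2) + (s3 + t3) := by rw [ep, eq]; abel
      rw [this, h]; abel))
  rw [hB] at hs2 ht2
  rcases ph_pair hs2 with h | h | h | h
  · exact absurd h a1
  · exact absurd h a2
  · rcases ph_pair ht2 with k | k | k | k
    · exact absurd k a3
    · exact absurd (by rw [h, k, add_comm]) a6
    · exact absurd k a4
    · exact Or.inl ⟨h, k⟩
  · rcases ph_pair ht2 with k | k | k | k
    · exact absurd k a3
    · exact Or.inr ⟨h, k⟩
    · exact absurd k a4
    · exact absurd (by rw [h, k, hh]) a5

open Module in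
/-- Classification of a fifth member with respect to the frame given by four members. -/
lemma ph_class {V : Type*} [AddCommGroup V] [Module (ZMod 2) V]
    (hV : finrank (ZMod 2) V = 6) (A B C D E : Submodule (ZMod 2) V)
    (hA : finrank (ZMod 2) A = 2) (hB : finrank (ZMod 2) B = 2) (hC : finrank (ZMod 2) C = 2)
    (hD : finrank (ZMod 2) D = 2) (hE : finrank (ZMod 2) E = 2)
    (hABC : A ⊔ B ⊔ C = ⊤) (hEBC : E ⊔ B ⊔ C = ⊤)
    (hABE : A ⊔ B ⊔ E = ⊤) (hACE : A ⊔ C ⊔ E = ⊤)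
    (hADE : A ⊔ D ⊔ E = ⊤) (hBDE : B ⊔ D ⊔ E = ⊤) (hCDE : C ⊔ D ⊔ E = ⊤)
    {u1 v1 u2 v2 u3 v3 : V}
    (eA : A = Submodule.span (ZMod 2) {u1, v1})
    (eB : B = Submodule.span (ZMod 2) {u2, v2})
    (eC : C = Submodule.span (ZMod 2) {u3, v3})
    (hu10 : u1 ≠ 0) (hv10 : v1 ≠ 0) (huv10 : u1 + v1 ≠ 0)
    (hu : u1 + u2 + u3 ∈ D) (hv : v1 + v2 + v3 ∈ D) :
    E = Submodule.span (ZMod 2) {u1 + v2 + (u3 + v3), v1 + (u2 + v2) + u3} ∨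
    E = Submodule.span (ZMod 2) {u1 + (u2 + v2) + v3, v1 + u2 + (u3 + v3)} := by
  have hu1 : u1 ∈ A := eA ▸ Submodule.subset_span (by simp)
  have hv1 : v1 ∈ A := eA ▸ Submodule.subset_span (by simp)
  have hu3 : u3 ∈ C := eC ▸ Submodule.subset_span (by simp)
  have hv3 : v3 ∈ C := eC ▸ Submodule.subset_span (by simp)
  have hu2 : u2 ∈ B := eB ▸ Submodule.subset_span (by simp)
  have hv2 : v2 ∈ B := eB ▸ Submodule.subset_span (by simp)
  have key : ∀ a : V, ∃ p ∈ E, ∃ s ∈ B, ∃ t ∈ C, p = a + s + t := by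
    intro a
    have : a ∈ E ⊔ B ⊔ C := hEBC ▸ Submodule.mem_top
    obtain ⟨y, hy, t, ht, e⟩ := Submodule.mem_sup.1 this
    obtain ⟨p, hp, s, hs, e'⟩ := Submodule.mem_sup.1 hy
    exact ⟨p, hp, -s, neg_mem hs, -t, neg_mem ht, by rw [← e, ← e']; abel⟩
  obtain ⟨p, hp, s2, hs2, s3, hs3, ep⟩ := key u1
  obtain ⟨q, hq, t2, ht2, t3, ht3, eq⟩ := key v1
  have hBCA : B ⊔ C ⊔ A = ⊤ := by rw [← hABC]; ac_rfl
  have tr := ph_trip hV B C A hB hC hA hBCA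
  have nz : ∀ a ∈ A, a ≠ 0 → ∀ s ∈ B, ∀ t ∈ C, a + s + t ≠ 0 := by
    intro a ha ha0 s hs t ht h
    refine ha0 (tr (-s) (neg_mem hs) (-t) (neg_mem ht) a ha ?_)
    have : a = (a + s + t) + (-s + -t) := by abel
    rw [this, h, zero_add]
  have hp0 : p ≠ 0 := ep ▸ nz _ hu1 hu10 _ hs2 _ hs3
  have hq0 : q ≠ 0 := eq ▸ nz _ hv1 hv10 _ ht2 _ ht3
  have hpq : p + q ≠ 0 := by
    have : p + q = (u1 + v1) + (s2 + t2) + (s3 + t3) := by rw [ep, eq]; abel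
    rw [this]
    exact nz _ (add_mem hu1 hv1) huv10 _ (add_mem hs2 ht2) _ (add_mem hs3 ht3)
  have r1 := ph_step A B C D E (ph_trip hV A C E hA hC hE hACE) (ph_trip hV C D E hC hD hE hCDE)
    eB hu1 hv1 hu3 hv3 hs2 ht2 hs3 ht3 hu hv hp hq ep eq hp0 hq0 hpq
  have r2 := ph_step A C B D E (ph_trip hV A B E hA hB hE hABE) (ph_trip hV B D E hB hD hE hBDE)
    eC hu1 hv1 hu2 hv2 hs3 ht3 hs2 ht2 (by rwa [add_right_comm]) (by rwa [add_right_comm]) hp hq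
    (by rw [ep]; abel) (by rw [eq]; abel) hp0 hq0 hpq
  have tA := ph_trip hV A D E hA hD hE hADE
  have hEs : Submodule.span (ZMod 2) {p, q} = E := by
    refine ph_full hV E B C _ hE hB hC ?_ ?_
    · rw [Submodule.span_le]
      rintro x (rfl | rfl)
      · exact hp
      · exact hq
    · rw [eq_top_iff, ← hABC]
      have hB' : B ≤ Submodule.span (ZMod 2) {p, q} ⊔ B ⊔ C := le_sup_right.trans le_sup_left
      have hC' : C ≤ Submodule.span (ZMod 2) {p, q} ⊔ B ⊔ C := le_sup_right
      have hP : Submodule.span (ZMod 2) {p, q} ≤ Submodule.span (ZMod 2) {p, q} ⊔ B ⊔ C :=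
        le_sup_left.trans le_sup_left
      refine sup_le (sup_le ?_ hB') hC'
      conv_lhs => rw [eA]
      rw [Submodule.span_le]
      rintro x (rfl | rfl)
      · have : x = p - s2 - s3 := by rw [ep]; abel
        rw [this]
        exact sub_mem (sub_mem (hP (Submodule.subset_span (by simp))) (hB' hs2)) (hC' hs3)
      · have : x = q - t2 - t3 := by rw [eq]; abel
        rw [this]
        exact sub_mem (sub_mem (hP (Submodule.subset_span (by simp))) (hB' ht2)) (hC' ht3)
  rcases r1 with ⟨h1, h2⟩ | ⟨h1, h2⟩ <;> rcases r2 with ⟨h3, h4⟩ | ⟨h3, h4⟩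
  · exact absurd (tA (u1 - v1) (sub_mem hu1 hv1) _ hv p hp (by rw [ep, h1, h3]; abel)) hp0
  · left; rw [← hEs, ep, eq, h1, h2, h3, h4]
  · right; rw [← hEs, ep, eq, h1, h2, h3, h4]
  · exact absurd (tA (v1 - u1) (sub_mem hv1 hu1) _ hu q hq (by rw [eq, h2, h4]; abel)) hq0

/-- The standard pseudo-hyperoval attached to six vectors. -/
def phStd {V : Type*} [AddCommGroup V] [Module (ZMod 2) V] (b : Fin 6 → V) :
    Set (Submodule (ZMod 2) V) :=
  {Submodule.span (ZMod 2) {b 0, b 1}, Submodule.span (ZMod 2) {b 2, b 3},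
   Submodule.span (ZMod 2) {b 4, b 5},
   Submodule.span (ZMod 2) {b 0 + b 2 + b 4, b 1 + b 3 + b 5},
   Submodule.span (ZMod 2) {b 0 + b 3 + (b 4 + b 5), b 1 + (b 2 + b 3) + b 4},
   Submodule.span (ZMod 2) {b 0 + (b 2 + b 3) + b 5, b 1 + b 2 + (b 4 + b 5)}}

open Module in
lemma ph_canon {V : Type*} [AddCommGroup V] [Module (ZMod 2) V]
    (hV : finrank (ZMod 2) V = 6) (O : Set (Submodule (ZMod 2) V))
    (hdim : ∀ U ∈ O, finrank (ZMod 2) U = 2) (hcard : O.ncard = 6)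
    (hspan : ∀ U₁ ∈ O, ∀ U₂ ∈ O, ∀ U₃ ∈ O,
      U₁ ≠ U₂ → U₁ ≠ U₃ → U₂ ≠ U₃ → U₁ ⊔ U₂ ⊔ U₃ = ⊤) :
    ∃ b : Basis (Fin 6) (ZMod 2) V, O = phStd b := by
  have : FiniteDimensional (ZMod 2) V := FiniteDimensional.of_finrank_pos (by omega)
  have hfin : O.Finite := Set.finite_of_ncard_pos (by omega)
  have : Finite O := hfin
  let f : O ≃ Fin 6 := Finite.equivFinOfCardEq (by rw [Nat.card_coe_set_eq, hcard])
  let U : Fin 6 → Submodule (ZMod 2) V := fun i => (f.symm i : Submodule (ZMod 2) V)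
  have hU : ∀ i, U i ∈ O := fun i => (f.symm i).2
  have hinj : Function.Injective U := Subtype.val_injective.comp f.symm.injective
  have hO : O = {U 0, U 1, U 2, U 3, U 4, U 5} := by
    ext X
    constructor
    · intro hX
      have hx : X = U (f ⟨X, hX⟩) := by simp [U]
      rw [hx]
      generalize f ⟨X, hX⟩ = i
      fin_cases i <;> simp
    · rintro (rfl | rfl | rfl | rfl | rfl | rfl) <;> exact hU _
  have hd : ∀ i, finrank (ZMod 2) (U i) = 2 := fun i => hdim _ (hU i)
  have hs : ∀ i j k, i ≠ j → i ≠ k → j ≠ k → U i ⊔ U j ⊔ U k = ⊤ := fun i j k h1 h2 h3 =>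
    hspan _ (hU i) _ (hU j) _ (hU k) (hinj.ne h1) (hinj.ne h2) (hinj.ne h3)
  -- basis of the first member
  let c : Basis (Fin 2) (ZMod 2) (U 0) := finBasisOfFinrankEq _ _ (hd 0)
  obtain ⟨u1, hu1⟩ : ∃ x, x = (c 0 : V) := ⟨_, rfl⟩
  obtain ⟨v1, hv1⟩ : ∃ x, x = (c 1 : V) := ⟨_, rfl⟩
  have hu1m : u1 ∈ U 0 := hu1 ▸ (c 0).2
  have hv1m : v1 ∈ U 0 := hv1 ▸ (c 1).2
  have hu10 : u1 ≠ 0 := by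
    rw [hu1]; simpa using c.ne_zero 0
  have hv10 : v1 ≠ 0 := by
    rw [hv1]; simpa using c.ne_zero 1
  have huv10 : u1 + v1 ≠ 0 := by
    intro h
    have h' : c 0 + c 1 = 0 := by
      apply Subtype.ext; simpa [hu1, hv1] using h
    have := congrArg (fun z => c.repr z 0) h'
    simp at this
  have eA : U 0 = Submodule.span (ZMod 2) {u1, v1} := by
    apply le_antisymm
    · intro x hx
      rw [Submodule.mem_span_pair]
      refine ⟨c.repr ⟨x, hx⟩ 0, c.repr ⟨x, hx⟩ 1, ?_⟩
      have := congrArg (Subtype.val) (c.sum_repr ⟨x, hx⟩)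
      rw [Fin.sum_univ_two] at this
      rw [hu1, hv1]
      exact this
    · rw [Submodule.span_le]
      rintro x (rfl | rfl)
      · exact hu1m
      · exact hv1m
  have key : ∀ a : V, ∃ p ∈ U 3, ∃ s ∈ U 1, ∃ t ∈ U 2, p = a + s + t := by
    intro a
    have : a ∈ U 3 ⊔ U 1 ⊔ U 2 := hs 3 1 2 (by decide) (by decide) (by decide) ▸ Submodule.mem_top
    obtain ⟨y, hy, t, ht, e⟩ := Submodule.mem_sup.1 this
    obtain ⟨p, hp, s, hs, e'⟩ := Submodule.mem_sup.1 hy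
    exact ⟨p, hp, -s, neg_mem hs, -t, neg_mem ht, by rw [← e, ← e']; abel⟩
  obtain ⟨p, hp, u2, hu2, u3, hu3, ep⟩ := key u1
  obtain ⟨q, hq, v2, hv2, v3, hv3, eq⟩ := key v1
  have hle : ∀ (W : Submodule (ZMod 2) V) (x y : V), x ∈ W → y ∈ W →
      Submodule.span (ZMod 2) {x, y} ≤ W := by
    intro W x y hx hy
    rw [Submodule.span_le]
    rintro z (rfl | rfl)
    · exact hx
    · exact hy
  have hm : ∀ x y : V, x ∈ Submodule.span (ZMod 2) {x, y} ∧ y ∈ Submodule.span (ZMod 2) {x, y} :=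
    fun x y => ⟨Submodule.subset_span (by simp), Submodule.subset_span (by simp)⟩
  have eD : Submodule.span (ZMod 2) {p, q} = U 3 := by
    refine ph_full hV _ (U 1) (U 2) _ (hd _) (hd _) (hd _) (hle _ _ _ hp hq) ?_
    rw [eq_top_iff, ← hs 0 1 2 (by decide) (by decide) (by decide)]
    have h1 : U 1 ≤ Submodule.span (ZMod 2) {p, q} ⊔ U 1 ⊔ U 2 := le_sup_right.trans le_sup_left
    have h2 : U 2 ≤ Submodule.span (ZMod 2) {p, q} ⊔ U 1 ⊔ U 2 := le_sup_right
    have hP : Submodule.span (ZMod 2) {p, q} ≤ Submodule.span (ZMod 2) {p, q} ⊔ U 1 ⊔ U 2 :=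
      le_sup_left.trans le_sup_left
    refine sup_le (sup_le (eA.le.trans (hle _ _ _ ?_ ?_)) h1) h2
    · have : u1 = p - u2 - u3 := by rw [ep]; abel
      rw [this]
      exact sub_mem (sub_mem (hP (hm p q).1) (h1 hu2)) (h2 hu3)
    · have : v1 = q - v2 - v3 := by rw [eq]; abel
      rw [this]
      exact sub_mem (sub_mem (hP (hm p q).2) (h1 hv2)) (h2 hv3)
  have eB : Submodule.span (ZMod 2) {u2, v2} = U 1 := by
    refine ph_full hV _ (U 0) (U 2) _ (hd _) (hd _) (hd _) (hle _ _ _ hu2 hv2) ?_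
    rw [eq_top_iff, ← hs 3 0 2 (by decide) (by decide) (by decide)]
    have h1 : U 0 ≤ Submodule.span (ZMod 2) {u2, v2} ⊔ U 0 ⊔ U 2 := le_sup_right.trans le_sup_left
    have h2 : U 2 ≤ Submodule.span (ZMod 2) {u2, v2} ⊔ U 0 ⊔ U 2 := le_sup_right
    have hP : Submodule.span (ZMod 2) {u2, v2} ≤ Submodule.span (ZMod 2) {u2, v2} ⊔ U 0 ⊔ U 2 :=
      le_sup_left.trans le_sup_left
    refine sup_le (sup_le (eD.ge.trans (hle _ _ _ ?_ ?_)) h1) h2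
    · rw [ep]
      exact add_mem (add_mem (h1 hu1m) (hP (hm _ _).1)) (h2 hu3)
    · rw [eq]
      exact add_mem (add_mem (h1 hv1m) (hP (hm _ _).2)) (h2 hv3)
  have eC : Submodule.span (ZMod 2) {u3, v3} = U 2 := by
    refine ph_full hV _ (U 0) (U 1) _ (hd _) (hd _) (hd _) (hle _ _ _ hu3 hv3) ?_
    rw [eq_top_iff, ← hs 3 0 1 (by decide) (by decide) (by decide)]
    have h1 : U 0 ≤ Submodule.span (ZMod 2) {u3, v3} ⊔ U 0 ⊔ U 1 := le_sup_right.trans le_sup_left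
    have h2 : U 1 ≤ Submodule.span (ZMod 2) {u3, v3} ⊔ U 0 ⊔ U 1 := le_sup_right
    have hP : Submodule.span (ZMod 2) {u3, v3} ≤ Submodule.span (ZMod 2) {u3, v3} ⊔ U 0 ⊔ U 1 :=
      le_sup_left.trans le_sup_left
    refine sup_le (sup_le (eD.ge.trans (hle _ _ _ ?_ ?_)) h1) h2
    · rw [ep]
      exact add_mem (add_mem (h1 hu1m) (h2 hu2)) (hP (hm _ _).1)
    · rw [eq]
      exact add_mem (add_mem (h1 hv1m) (h2 hv2)) (hP (hm _ _).2)
  have cl : ∀ i : Fin 6, 3 < i → _ := fun i (hi : 3 < i) =>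
    ph_class hV (U 0) (U 1) (U 2) (U 3) (U i) (hd _) (hd _) (hd _) (hd _) (hd _)
      (hs _ _ _ (by decide) (by decide) (by decide))
      (hs _ _ _ (by omega) (by omega) (by decide))
      (hs _ _ _ (by decide) (by omega) (by omega))
      (hs _ _ _ (by decide) (by omega) (by omega))
      (hs _ _ _ (by decide) (by omega) (by omega))
      (hs _ _ _ (by decide) (by omega) (by omega))
      (hs _ _ _ (by decide) (by omega) (by omega))
      eA eB.symm eC.symm hu10 hv10 huv10 (ep ▸ hp) (eq ▸ hq)
  have hne : U 4 ≠ U 5 := hinj.ne (by decide)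
  let w : Fin 6 → V := ![u1, v1, u2, v2, u3, v3]
  have hw : ∀ i, w i ∈ Submodule.span (ZMod 2) (Set.range w) :=
    fun i => Submodule.subset_span ⟨i, rfl⟩
  have htop : ⊤ ≤ Submodule.span (ZMod 2) (Set.range w) := by
    rw [← hs 0 1 2 (by decide) (by decide) (by decide), eA, ← eB, ← eC]
    exact sup_le (sup_le (hle _ _ _ (hw 0) (hw 1)) (hle _ _ _ (hw 2) (hw 3)))
      (hle _ _ _ (hw 4) (hw 5))
  refine ⟨basisOfTopLeSpanOfCardEqFinrank w htop (by simp [hV]), ?_⟩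
  rw [coe_basisOfTopLeSpanOfCardEqFinrank]
  have hstd : phStd w = {Submodule.span (ZMod 2) {u1, v1}, Submodule.span (ZMod 2) {u2, v2},
    Submodule.span (ZMod 2) {u3, v3},
    Submodule.span (ZMod 2) {u1 + u2 + u3, v1 + v2 + v3},
    Submodule.span (ZMod 2) {u1 + v2 + (u3 + v3), v1 + (u2 + v2) + u3},
    Submodule.span (ZMod 2) {u1 + (u2 + v2) + v3, v1 + u2 + (u3 + v3)}} := rfl
  rw [hstd, hO, ← eA, eB, eC, ← ep, ← eq, eD]
  rcases cl 4 (by decide) with h4 | h4 <;> rcases cl 5 (by decide) with h5 | h5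
  · exact absurd (h4.trans h5.symm) hne
  · rw [← h4, ← h5]
  · rw [← h4, ← h5, Set.pair_comm (U 4)]
  · exact absurd (h4.trans h5.symm) hne

lemma ph_map {V : Type*} [AddCommGroup V] [Module (ZMod 2) V] (b : Fin 6 → V)
    (g : V ≃ₗ[ZMod 2] V) :
    (Submodule.map g.toLinearMap) '' phStd b = phStd (fun i => g (b i)) := by
  simp only [phStd, Set.image_insert_eq, Set.image_singleton, Submodule.map_span,
    LinearEquiv.coe_coe, map_add]

/-- **Uniqueness of the pseudo-hyperoval of `PG(5,2)`.** Any two pseudo-hyperovals of a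
`6`-dimensional `𝔽₂`-vector space (sets of six `2`-dimensional subspaces any three of
which span) are equivalent under an `𝔽₂`-linear automorphism. -/
theorem pseudo_hyperoval_PG_5_2_unique
    {V : Type*} [AddCommGroup V] [Module (ZMod 2) V]
    (hV : Module.finrank (ZMod 2) V = 6)
    (O₁ O₂ : Set (Submodule (ZMod 2) V))
    (hO₁dim : ∀ U ∈ O₁, Module.finrank (ZMod 2) U = 2)
    (hO₁card : O₁.ncard = 6)
    (hO₁span : ∀ U₁ ∈ O₁, ∀ U₂ ∈ O₁, ∀ U₃ ∈ O₁,
      U₁ ≠ U₂ → U₁ ≠ U₃ → U₂ ≠ U₃ → U₁ ⊔ U₂ ⊔ U₃ = ⊤)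
    (hO₂dim : ∀ U ∈ O₂, Module.finrank (ZMod 2) U = 2)
    (hO₂card : O₂.ncard = 6)
    (hO₂span : ∀ U₁ ∈ O₂, ∀ U₂ ∈ O₂, ∀ U₃ ∈ O₂,
      U₁ ≠ U₂ → U₁ ≠ U₃ → U₂ ≠ U₃ → U₁ ⊔ U₂ ⊔ U₃ = ⊤) :
    ∃ g : V ≃ₗ[ZMod 2] V, (Submodule.map g.toLinearMap) '' O₁ = O₂ := by
  obtain ⟨b, hb⟩ := ph_canon hV O₁ hO₁dim hO₁card hO₁span
  obtain ⟨c, hc⟩ := ph_canon hV O₂ hO₂dim hO₂card hO₂span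
  refine ⟨b.equiv c (Equiv.refl _), ?_⟩
  rw [hb, hc, ph_map]
  simp
end
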